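/- Fix t ∈ (1,2], c ∈ (−1,1) and integers q₁, q₂ ≥ 1 such that f_{t,c}^j(a₁) ∈ [−1,1] ∖ {c} for 0 ≤ j < q₁ − 1 and f_{t,c}^{q₁−1}(a₁) = c, and f_{t,c}^j(b₁) ∈ [−1,1] ∖ {c} for 0 ≤ j < q₂ − 1 and f_{t,c}^{q₂−1}(b₁) = c (both critical values are periodic). For w = (w₁, w₂) ∈ ℝ² define t(w) = 1 + (w₁ − w₂)/2 and c(w) = (w₁ + w₂)/(2·t(w)), and define real-analytic iterates following the same branches as the unperturbed orbit: x₀(w) = w₁ and x_{k+1}(w) = t(w)·x_k(w) + σ_k·(t(w) − 1) where σ_k = +1 if f_{t,c}^k(a₁) < c and σ_k = −1 if f_{t,c}^k(a₁) > c (for 0 ≤ k ≤ q₁ − 2); similarly y₀(w) = w₂ and y_{k+1}(w) = t(w)·y_k(w) + τ_k·(t(w) − 1) with τ_k = +1 if f_{t,c}^k(b₁) < c and τ_k = −1 if f_{t,c}^k(b₁) > c (for 0 ≤ k ≤ q₂ − 2). Then the map ℛ(w) = (x_{q₁−1}(w) − c(w), y_{q₂−1}(w) − c(w)) has strictly positive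 Jacobian determinant at w = (a₁, b₁); in particular ℛ is locally invertible at (a₁, b₁). -/

import Mathlib

/-- The affine Lorenz map `f_{t,c}` (with an arbitrary convention at the discontinuity `c`). -/
noncomputable def lorenz (t c : ℝ) (x : ℝ) : ℝ :=
  if x < c then t * x + (t - 1) else t * x - (t - 1)

/-- The slope parameter `t(w) = 1 + (w₁ − w₂)/2`. -/
noncomputable def tpar (w : ℝ × ℝ) : ℝ := 1 + (w.1 - w.2) / 2

/-- The critical point parameter `c(w) = (w₁ + w₂)/(2·t(w))`. -/
noncomputable def cpar (w : ℝ × ℝ) : ℝ := (w.1 + w.2) / (2 * tpar w)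

/-- The sign `σ_k`: `+1` if the `k`-th iterate of the critical value lies in the left
(increasing, `+(t−1)`) branch and `−1` if it lies in the right branch. -/
noncomputable def lorenzSign (t c a : ℝ) (k : ℕ) : ℝ :=
  if (lorenz t c)^[k] a < c then 1 else -1

/-- The real-analytic iterates following prescribed branches:
`x₀(w) = x0(w)` and `x_{k+1}(w) = t(w)·x_k(w) + σ_k·(t(w) − 1)`. -/
noncomputable def branchIter (x0 : ℝ × ℝ → ℝ) (σ : ℕ → ℝ) : ℕ → (ℝ × ℝ) → ℝ
  | 0 => x0
  | k + 1 => fun w => tpar w * branchIter x0 σ k w + σ k * (tpar w - 1)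

open MeasureTheory

/-- Weighted sum `∑_{j<k} t^{k-1-j} x_j`, defined recursively. -/
noncomputable def wsum (t : ℝ) (x : ℕ → ℝ) : ℕ → ℝ
  | 0 => 0
  | k + 1 => t * wsum t x k + x k

/-- Signed indicator between `c` and `p`. -/
noncomputable def psi (c p z : ℝ) : ℝ := (if z < p then 1 else 0) - (if z < c then 1 else 0)

/-- Transfer operator of the Lorenz map. -/
noncomputable def Lop (t c : ℝ) (g : ℝ → ℝ) (x : ℝ) : ℝ :=
  t⁻¹ * ((Set.Iio c).indicator g ((x - (t - 1)) / t) + (Set.Ici c).indicator g ((x + (t - 1)) / t))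

/-- Locally constant to the right. -/
def RC (g : ℝ → ℝ) : Prop := ∀ x, ∃ e > 0, ∀ y, x ≤ y → y < x + e → g y = g x

/-- Integrable, right locally constant, bounded support. -/
def Good (g : ℝ → ℝ) : Prop := Integrable g ∧ RC g ∧ ∃ M, ∀ x, M ≤ |x| → g x = 0

theorem RC.map2 {g h : ℝ → ℝ} (hg : RC g) (hh : RC h) (F : ℝ → ℝ → ℝ) :
    RC (fun x => F (g x) (h x)) := by
  intro x
  obtain ⟨e, he, h1⟩ := hg x
  obtain ⟨d, hd, h2⟩ := hh x
  refine ⟨min e d, lt_min he hd, fun y hy hy' => ?_⟩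
  have := min_le_left e d
  have := min_le_right e d
  simp only [h1 y hy (by linarith), h2 y hy (by linarith)]

theorem RC.comp_affine {g : ℝ → ℝ} (hg : RC g) {t : ℝ} (ht : 0 < t) (b : ℝ) :
    RC (fun x => g ((x + b) / t)) := by
  intro x
  obtain ⟨e, he, h1⟩ := hg ((x + b) / t)
  refine ⟨t * e, by positivity, fun y hy hy' => h1 _ (by gcongr) ?_⟩
  rw [div_add' _ _ _ ht.ne', div_lt_div_iff_of_pos_right ht]
  linarith

theorem RC_Iio (c : ℝ) : RC (fun z => if z < c then 1 else 0) := by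
  intro x
  by_cases h : x < c
  · refine ⟨c - x, by linarith, fun y _ hy' => ?_⟩
    simp [h, show y < c by linarith]
  · refine ⟨1, by norm_num, fun y hy _ => ?_⟩
    simp [h, show ¬ y < c by linarith]

theorem RC_Lop {t c : ℝ} (ht : 0 < t) {g : ℝ → ℝ} (hg : RC g) : RC (Lop t c g) := by
  have h1 : RC ((Set.Iio c).indicator g) := by
    convert (RC_Iio c).map2 hg (fun a b => a * b) using 2 with z
    simp [Set.indicator_apply]
  have h2 : RC ((Set.Ici c).indicator g) := by
    convert (RC_Iio c).map2 hg (fun a b => (1 - a) * b) using 2 with z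
    by_cases h : z < c
    · simp [Set.indicator_apply, h]
    · simp [Set.indicator_apply, h, not_lt.mp h]
  exact (h1.comp_affine ht (-(t - 1))).map2 (h2.comp_affine ht (t - 1)) (fun a b => t⁻¹ * (a + b))

theorem integrable_Lop {t c : ℝ} (ht : 0 < t) {g : ℝ → ℝ} (hg : Integrable g) :
    Integrable (Lop t c g) ∧ ∫ x, Lop t c g x = ∫ x, g x := by
  have i1 : Integrable ((Set.Iio c).indicator g) := hg.indicator measurableSet_Iio
  have i2 : Integrable ((Set.Ici c).indicator g) := hg.indicator measurableSet_Ici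
  have j1 : Integrable (fun x => (Set.Iio c).indicator g ((x - (t - 1)) / t)) :=
    (i1.comp_div ht.ne').comp_sub_right (t - 1)
  have j2 : Integrable (fun x => (Set.Ici c).indicator g ((x + (t - 1)) / t)) :=
    (i2.comp_div ht.ne').comp_add_right (t - 1)
  refine ⟨(j1.add j2).const_mul t⁻¹, ?_⟩
  unfold Lop
  rw [integral_const_mul, integral_add j1 j2,
    integral_sub_right_eq_self (fun x => (Set.Iio c).indicator g (x / t)),
    integral_add_right_eq_self (fun x => (Set.Ici c).indicator g (x / t)),
    Measure.integral_comp_div, Measure.integral_comp_div, abs_of_pos ht, ← smul_add,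
    ← integral_add i1 i2, smul_eq_mul, inv_mul_cancel_left₀ ht.ne']
  congr 1
  ext x
  by_cases h : x < c
  · simp [Set.indicator_apply, h]
  · simp [Set.indicator_apply, h, not_lt.mp h]

theorem RC_pos {g : ℝ → ℝ} (hi : Integrable g) (hg : RC g) (h0 : ∀ x, 0 ≤ g x) {x : ℝ}
    (hx : 0 < g x) : 0 < ∫ y, g y := by
  rw [integral_pos_iff_support_of_nonneg h0 hi]
  obtain ⟨e, he, h1⟩ := hg x
  refine lt_of_lt_of_le ?_ (measure_mono (show Set.Ico x (x + e) ⊆ _ from ?_))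
  · simp [he]
  · intro y hy
    simp only [Function.mem_support]
    rw [h1 y hy.1 hy.2]
    exact hx.ne'

theorem core {t c : ℝ} (ht : 1 < t) {h : ℝ → ℝ} (hh : Good h) (hL : ∀ x, Lop t c h x = h x)
    {x : ℝ} (hx : 0 < h x) : 0 < h c := by
  have t0 : 0 < t := by linarith
  obtain ⟨hi, hrc, M, hM⟩ := hh
  set g : ℝ → ℝ := fun x => max (h x) 0 with hgdef
  have g0 : ∀ x, 0 ≤ g x := fun x => le_max_right _ _
  have hg : ∀ x, h x ≤ g x := fun x => le_max_left _ _
  have gi : Integrable g := hi.pos_part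
  have grc : RC g := hrc.map2 hrc (fun a _ => max a 0)
  have key : ∀ x, g x ≤ Lop t c g x := by
    intro x
    refine max_le ?_ ?_
    · rw [← hL x]
      unfold Lop
      gcongr <;> exact hg _
    · unfold Lop
      have := Set.indicator_nonneg (s := Set.Iio c) (fun x _ => g0 x) ((x - (t - 1)) / t)
      have := Set.indicator_nonneg (s := Set.Ici c) (fun x _ => g0 x) ((x + (t - 1)) / t)
      positivity
  have Lg : ∀ x, Lop t c g x = g x := by
    intro x
    by_contra hne
    obtain ⟨li, le⟩ := integrable_Lop (c := c) t0 gi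
    have := RC_pos (li.sub gi) ((RC_Lop (c := c) t0 grc).map2 grc (fun a b => a - b))
      (fun x => sub_nonneg.mpr (key x)) (x := x) (sub_pos.mpr (lt_of_le_of_ne (key x) (Ne.symm hne)))
    have h2 := integral_sub li gi
    simp only [Pi.sub_apply] at this
    linarith
  have fwdL : ∀ z, (z - (t - 1)) / t < c → 0 < g ((z - (t - 1)) / t) → 0 < g z := by
    intro z hz hp
    rw [← Lg]
    unfold Lop
    have := Set.indicator_nonneg (s := Set.Ici c) (fun x _ => g0 x) ((z + (t - 1)) / t)
    rw [Set.indicator_of_mem (show _ ∈ Set.Iio c from hz)]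
    positivity
  have fwdR : ∀ z, c ≤ (z + (t - 1)) / t → 0 < g ((z + (t - 1)) / t) → 0 < g z := by
    intro z hz hp
    rw [← Lg]
    unfold Lop
    have := Set.indicator_nonneg (s := Set.Iio c) (fun x _ => g0 x) ((z - (t - 1)) / t)
    rw [Set.indicator_of_mem (show _ ∈ Set.Ici c from hz)]
    positivity
  by_contra hc
  have gc : ¬ 0 < g c := by simpa [hgdef] using hc
  obtain ⟨e, he, h1⟩ := hrc x
  have grow : ∀ n : ℕ, ∃ p, ∀ z, p ≤ z → z < p + t ^ n * e → 0 < g z := by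
    intro n
    induction n with
    | zero =>
      refine ⟨x, fun z hz hz' => lt_of_lt_of_le ?_ (hg z)⟩
      rw [h1 z hz (by linarith)]
      exact hx
    | succ n ih =>
      obtain ⟨p, hp⟩ := ih
      have hpos : 0 < t ^ n * e := by positivity
      by_cases hpc : c < p
      · refine ⟨t * p - (t - 1), fun z hz hz' => ?_⟩
        have e1 : p ≤ (z + (t - 1)) / t := by rw [le_div_iff₀ t0]; linarith
        refine fwdR z (by linarith) (hp _ e1 ?_)
        rw [div_lt_iff₀ t0]
        rw [pow_succ] at hz'
        nlinarith
      · have hpc' : p + t ^ n * e ≤ c := by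
          by_contra hcon
          exact gc (hp c (by linarith) (by linarith))
        refine ⟨t * p + (t - 1), fun z hz hz' => ?_⟩
        have e1 : p ≤ (z - (t - 1)) / t := by rw [le_div_iff₀ t0]; linarith
        have e2 : (z - (t - 1)) / t < p + t ^ n * e := by
          rw [div_lt_iff₀ t0]
          rw [pow_succ] at hz'
          nlinarith
        exact fwdL z (by linarith) (hp _ e1 e2)
  obtain ⟨n, hn⟩ := pow_unbounded_of_one_lt ((2 * |M| + 1) / e) ht
  rw [div_lt_iff₀ he] at hn
  obtain ⟨p, hp⟩ := grow n
  have gM : ∀ z, M ≤ |z| → ¬ 0 < g z := by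
    intro z hz
    simp [hgdef, hM z hz]
  have hMM := le_abs_self M
  have hM0 := abs_nonneg M
  by_cases hpM : |M| ≤ p
  · exact gM p (by linarith [le_abs_self p]) (hp p le_rfl (by linarith))
  · by_cases hpM' : p ≤ -|M|
    · exact gM p (by linarith [neg_le_abs p]) (hp p le_rfl (by linarith))
    · exact gM |M| (by rw [abs_abs]; exact hMM) (hp |M| (by linarith) (by linarith))

theorem Good.add {g h : ℝ → ℝ} (hg : Good g) (hh : Good h) (a b : ℝ) :
    Good (fun x => a * g x + b * h x) := by
  obtain ⟨i1, r1, M, hM⟩ := hg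
  obtain ⟨i2, r2, N, hN⟩ := hh
  refine ⟨(i1.const_mul a).add (i2.const_mul b), r1.map2 r2 (fun u v => a * u + b * v),
    max M N, fun x hx => ?_⟩
  simp [hM x ((le_max_left _ _).trans hx), hN x ((le_max_right _ _).trans hx)]

theorem psi_eq (c p : ℝ) :
    psi c p = fun z => (Set.Ico c p).indicator 1 z - (Set.Ico p c).indicator 1 z := by
  ext z
  unfold psi
  simp only [Set.indicator_apply, Set.mem_Ico, Pi.one_apply]
  by_cases h1 : z < p <;> by_cases h2 : z < c <;> simp_all [not_lt.mp, not_le.mpr]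

theorem Good_psi (c p : ℝ) : Good (psi c p) ∧ ∫ z, psi c p z = p - c := by
  have i1 : Integrable ((Set.Ico c p).indicator (1 : ℝ → ℝ)) :=
    (integrable_indicator_iff measurableSet_Ico).mpr (by
      simpa [Pi.one_def] using integrableOn_const (by simp) (by simp))
  have i2 : Integrable ((Set.Ico p c).indicator (1 : ℝ → ℝ)) :=
    (integrable_indicator_iff measurableSet_Ico).mpr (by
      simpa [Pi.one_def] using integrableOn_const (by simp) (by simp))
  refine ⟨⟨?_, (RC_Iio p).map2 (RC_Iio c) (fun a b => a - b), |c| + |p| + 1, fun x hx => ?_⟩, ?_⟩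
  · rw [psi_eq]; exact i1.sub i2
  · unfold psi
    have := abs_nonneg c
    have := abs_nonneg p
    have := le_abs_self c
    have := le_abs_self p
    have := neg_le_abs c
    have := neg_le_abs p
    rcases le_total 0 x with h | h
    · rw [abs_of_nonneg h] at hx
      simp [show ¬ x < p by linarith, show ¬ x < c by linarith]
    · rw [abs_of_nonpos h] at hx
      by_cases h0 : x < c
      · by_cases h1 : x < p
        · simp [h0, h1]
        · exfalso; linarith
      · by_cases h1 : x < p
        · exfalso; linarith
        · simp [h0, h1]
  · rw [psi_eq, integral_sub i1 i2, integral_indicator_one measurableSet_Ico,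
      integral_indicator_one measurableSet_Ico]
    simp only [Measure.real, Real.volume_Ico]
    rcases le_total c p with h | h
    · rw [ENNReal.toReal_ofReal (by linarith), ENNReal.ofReal_of_nonpos (by linarith)]; simp
    · rw [ENNReal.ofReal_of_nonpos (by linarith), ENNReal.toReal_ofReal (by linarith)]; simp

theorem Good_wsum (t c : ℝ) (x : ℕ → ℝ) (n : ℕ) :
    Good (fun z => wsum t (fun k => psi c (x k) z) n) ∧
      ∫ z, wsum t (fun k => psi c (x k) z) n = wsum t (fun k => x k - c) n := by
  induction n with
  | zero =>
    simp only [wsum, integral_zero, and_true]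
    exact ⟨integrable_zero _ _ _, fun x => ⟨1, by norm_num, fun _ _ _ => rfl⟩, 0, fun _ _ => rfl⟩
  | succ n ih =>
    obtain ⟨hG, hI⟩ := ih
    obtain ⟨pG, pI⟩ := Good_psi c (x n)
    simp only [wsum]
    refine ⟨by simpa using hG.add pG t 1, ?_⟩
    rw [integral_add (hG.1.const_mul t) pG.1, integral_const_mul, hI, pI]

theorem Lop_add (t c : ℝ) (g h : ℝ → ℝ) (a b : ℝ) (x : ℝ) :
    Lop t c (fun z => a * g z + b * h z) x = a * Lop t c g x + b * Lop t c h x := by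
  unfold Lop
  simp only [Set.indicator_apply]
  split_ifs <;> ring

theorem Lop_psi {t c p s : ℝ} (ht : 1 < t) (hp : (p < c ∧ s = 1) ∨ (c < p ∧ s = -1)) (z : ℝ) :
    t * Lop t c (psi c p) z = psi c (t * p + s * (t - 1)) z
      - ((1 + s) / 2 * psi c (t * c + (t - 1)) z + (1 - s) / 2 * psi c (t * c - (t - 1)) z) := by
  have t0 : 0 < t := by linarith
  unfold Lop
  rw [mul_inv_cancel_left₀ t0.ne']
  simp only [Set.indicator_apply, Set.mem_Iio, Set.mem_Ici, psi, div_lt_iff₀ t0, le_div_iff₀ t0]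
  have q1 : z - (t - 1) < c * t ↔ z < t * c + (t - 1) := by
    constructor <;> intro <;> linarith
  have q2 : c * t ≤ z + (t - 1) ↔ ¬ z < t * c - (t - 1) := by
    rw [not_lt]; constructor <;> intro <;> linarith
  have q3 : z + (t - 1) < c * t ↔ z < t * c - (t - 1) := by
    constructor <;> intro <;> linarith
  have q4 : z - (t - 1) < p * t ↔ z < t * p + (t - 1) := by
    constructor <;> intro <;> linarith
  have q5 : z + (t - 1) < p * t ↔ z < t * p - (t - 1) := by
    constructor <;> intro <;> linarith
  simp only [q1, q2, q3, q4, q5]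
  rcases hp with ⟨hp, rfl⟩ | ⟨hp, rfl⟩
  · have : t * p < t * c := by gcongr
    rw [one_mul]
    split_ifs <;> first | (exfalso; linarith) | norm_num
  · have : t * c < t * p := by gcongr
    rw [neg_one_mul, ← sub_eq_add_neg]
    split_ifs <;> first | (exfalso; linarith) | norm_num

theorem Lop_wsum {t c : ℝ} (ht : 1 < t) (x σ : ℕ → ℝ) (n : ℕ)
    (hx : ∀ k, x (k + 1) = t * x k + σ k * (t - 1))
    (hσ : ∀ k, k < n → (x k < c ∧ σ k = 1) ∨ (c < x k ∧ σ k = -1)) (z : ℝ) :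
    ∀ k, k ≤ n → t * Lop t c (fun z => wsum t (fun k => psi c (x k) z) k) z =
      wsum t (fun k => psi c (x k) z) (k + 1) - t ^ k * psi c (x 0) z
      - 1 / 2 * ((t ^ k - 1) / (t - 1) *
            (psi c (t * c + (t - 1)) z + psi c (t * c - (t - 1)) z)
          + (x k - t ^ k * x 0) / (t - 1) *
            (psi c (t * c + (t - 1)) z - psi c (t * c - (t - 1)) z)) := by
  have t1 : t - 1 ≠ 0 := by linarith
  intro k
  induction k with
  | zero =>
    intro _
    simp [wsum, Lop]
  | succ k ih =>
    intro hk
    have h1 := ih (by omega)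
    have h2 := Lop_psi ht (hσ k (by omega)) z
    rw [← hx] at h2
    have h3 := Lop_add t c (fun z => wsum t (fun k => psi c (x k) z) k) (psi c (x k)) t 1 z
    simp only [one_mul] at h3
    simp only [wsum] at h1 ⊢
    rw [h3, mul_add, h2, h1, hx k]
    field_simp
    ring

theorem Lop_G {t c s : ℝ} (ht : 1 < t) (x σ : ℕ → ℝ) (n : ℕ) (hs : s = 1 ∨ s = -1)
    (h0 : x 0 = t * c + s * (t - 1)) (hn : x n = c)
    (hx : ∀ k, x (k + 1) = t * x k + σ k * (t - 1))
    (hσ : ∀ k, k < n → (x k < c ∧ σ k = 1) ∨ (c < x k ∧ σ k = -1)) (z : ℝ) :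
    Lop t c (fun z => wsum t (fun k => psi c (x k) z) (n + 1)) z =
      wsum t (fun k => psi c (x k) z) (n + 1) - (t ^ (n + 1) - 1) *
       (1 / 2 / (t - 1) * ((1 - c) * psi c (t * c + (t - 1)) z
          + (1 + c) * psi c (t * c - (t - 1)) z)) := by
  have t1 : t - 1 ≠ 0 := by linarith
  have h1 := Lop_wsum ht x σ n hx hσ z n le_rfl
  have h3 := Lop_add t c (fun z => wsum t (fun k => psi c (x k) z) n) (psi c (x n)) t 0 z
  have h4 : ∀ z, psi c (x n) z = 0 := by intro z; simp [psi, hn]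
  have h5 : (fun z => wsum t (fun k => psi c (x k) z) (n + 1)) =
      fun z => t * wsum t (fun k => psi c (x k) z) n + 0 * psi c (x n) z := by
    ext z; simp [wsum, h4]
  have h6 : psi c (x 0) z = (1 + s) / 2 * psi c (t * c + (t - 1)) z
      + (1 - s) / 2 * psi c (t * c - (t - 1)) z := by
    rw [h0]
    rcases hs with rfl | rfl
    · simp
    · rw [neg_one_mul, ← sub_eq_add_neg]; norm_num
  rw [h5, h3, zero_mul, add_zero, h1, h6, hn, h0]
  rw [pow_succ]
  field_simp
  ring

/-- Sign-free positivity of the total mass of the Parry density. -/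
theorem main_pos {t c : ℝ} (ht : 1 < t) (hc : -1 < c) (x σ y τ : ℕ → ℝ) (n m : ℕ)
    (hx0 : x 0 = t * c + (t - 1)) (hy0 : y 0 = t * c - (t - 1)) (hx1 : x 0 ≤ 1)
    (hn : x n = c) (hm : y m = c)
    (hx : ∀ k, x (k + 1) = t * x k + σ k * (t - 1))
    (hy : ∀ k, y (k + 1) = t * y k + τ k * (t - 1))
    (hσ : ∀ k, k < n → (x k < c ∧ σ k = 1) ∨ (c < x k ∧ σ k = -1))
    (hτ : ∀ k, k < m → (y k < c ∧ τ k = 1) ∨ (c < y k ∧ τ k = -1)) :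
    wsum t (fun k => y k - c) (m + 1) / (t ^ (m + 1) - 1) <
      wsum t (fun k => x k - c) (n + 1) / (t ^ (n + 1) - 1) := by
  have t0 : 0 < t := by linarith
  have A0 : 0 < t ^ (n + 1) - 1 := by linarith [one_lt_pow₀ ht (Nat.add_one_ne_zero n)]
  have B0 : 0 < t ^ (m + 1) - 1 := by linarith [one_lt_pow₀ ht (Nat.add_one_ne_zero m)]
  set GA := fun z => wsum t (fun k => psi c (x k) z) (n + 1) with hGA
  set GB := fun z => wsum t (fun k => psi c (y k) z) (m + 1) with hGB
  obtain ⟨gA, iA⟩ := Good_wsum t c x (n + 1)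
  obtain ⟨gB, iB⟩ := Good_wsum t c y (m + 1)
  set a := (t ^ (n + 1) - 1)⁻¹ with ha
  set b := (t ^ (m + 1) - 1)⁻¹ with hb
  have a0 : 0 < a := inv_pos.mpr A0
  have b0 : 0 < b := inv_pos.mpr B0
  have gh : ∀ r, Good (fun z => r * a * GA z + -(r * b) * GB z) := fun r => gA.add gB _ _
  have Lh : ∀ r z, Lop t c (fun z => r * a * GA z + -(r * b) * GB z) z
      = r * a * GA z + -(r * b) * GB z := by
    intro r z
    rw [Lop_add, hGA, hGB,
      Lop_G (s := 1) ht x σ n (Or.inl rfl) (by rw [hx0]; ring) hn hx hσ z,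
      Lop_G (s := -1) ht y τ m (Or.inr rfl) (by rw [hy0]; ring) hm hy hτ z, ha, hb]
    have := A0.ne'
    have := B0.ne'
    field_simp
    ring
  -- positivity near `a₁`
  have hcx : c < x 0 := by rw [hx0]; nlinarith
  have hylt : ∀ k, k ≤ m → y k < x 0 := by
    intro k
    induction k with
    | zero => intro _; rw [hx0, hy0]; linarith
    | succ k ih =>
      intro hk
      have h1 := ih (by omega)
      rw [hy k]
      rcases hτ k (by omega) with ⟨h, e⟩ | ⟨h, e⟩
      · rw [e, hx0]
        nlinarith
      · rw [e]
        nlinarith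
  have hz : ∃ z, c ≤ z ∧ z < x 0 ∧ ∀ k, k ≤ m → y k ≤ z := by
    have : ∀ j, j ≤ m → ∃ z, c ≤ z ∧ z < x 0 ∧ ∀ k, k ≤ j → y k ≤ z := by
      intro j
      induction j with
      | zero =>
        intro _
        refine ⟨max c (y 0), le_max_left _ _, max_lt hcx (hylt 0 (by omega)), fun k hk => ?_⟩
        obtain rfl : k = 0 := by omega
        exact le_max_right _ _
      | succ j ih =>
        intro hj
        obtain ⟨z, h1, h2, h3⟩ := ih (by omega)
        refine ⟨max z (y (j + 1)), h1.trans (le_max_left _ _), max_lt h2 (hylt _ hj), fun k hk => ?_⟩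
        rcases Nat.lt_or_ge j k with h | h
        · obtain rfl : k = j + 1 := by omega
          exact le_max_right _ _
        · exact (h3 k h).trans (le_max_left _ _)
    exact this m le_rfl
  obtain ⟨z, hcz, hzx, hyz⟩ := hz
  have hBz : GB z = 0 := by
    have : ∀ k, k ≤ m + 1 → wsum t (fun k => psi c (y k) z) k = 0 := by
      intro k
      induction k with
      | zero => intro _; rfl
      | succ k ih =>
        intro hk
        rw [wsum, ih (by omega)]
        simp [psi, not_lt.mpr hcz, not_lt.mpr (hyz k (by omega))]
    exact this _ le_rfl
  have hAz : 0 < GA z := by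
    have : ∀ k, 0 < wsum t (fun k => psi c (x k) z) (k + 1) := by
      intro k
      induction k with
      | zero => simp [wsum, psi, not_lt.mpr hcz, hzx]
      | succ k ih =>
        rw [wsum]
        have : 0 ≤ psi c (x (k + 1)) z := by
          simp only [psi, not_lt.mpr hcz, if_false, sub_zero]
          split_ifs <;> norm_num
        positivity
    exact this n
  have pc := core ht (gh 1) (Lh 1) (x := z) (by rw [hBz]; simp only [mul_zero, add_zero, one_mul]; positivity)
  have hnn : ∀ w, 0 ≤ 1 * a * GA w + -(1 * b) * GB w := by
    intro w
    by_contra hneg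
    have := core ht (gh (-1)) (Lh (-1)) (x := w) (by linarith)
    linarith
  have fin := RC_pos (gh 1).1 (gh 1).2.1 hnn pc
  rw [integral_add (gA.1.const_mul _) (gB.1.const_mul _), integral_const_mul, integral_const_mul,
    iA, iB] at fin
  rw [div_eq_mul_inv, div_eq_mul_inv, ← ha, ← hb]
  linarith

theorem det_prod (A : ℝ × ℝ →L[ℝ] ℝ × ℝ) :
    A.det = (A (1, 0)).1 * (A (0, 1)).2 - (A (0, 1)).1 * (A (1, 0)).2 := by
  rw [ContinuousLinearMap.det, ← LinearMap.det_toMatrix (Module.Basis.finTwoProd ℝ),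
    Matrix.det_fin_two]
  simp [LinearMap.toMatrix_apply]

/-- The differential of `tpar`. -/
noncomputable def dT : ℝ × ℝ →L[ℝ] ℝ :=
  (1 / 2 : ℝ) • (ContinuousLinearMap.fst ℝ ℝ ℝ - ContinuousLinearMap.snd ℝ ℝ ℝ)

theorem hasFDerivAt_tpar (w : ℝ × ℝ) : HasFDerivAt tpar dT w := by
  have h := ((hasFDerivAt_fst (𝕜 := ℝ) (p := w)).sub (hasFDerivAt_snd (𝕜 := ℝ) (p := w))).const_mul
    (1 / 2 : ℝ) |>.const_add (1 : ℝ)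
  refine h.congr_of_eventuallyEq (Filter.Eventually.of_forall fun v => ?_)
  simp only [tpar, Pi.sub_apply]
  ring

theorem hasFDerivAt_cpar (w : ℝ × ℝ) (hw : tpar w ≠ 0) :
    HasFDerivAt cpar ((1 / (2 * tpar w)) • (ContinuousLinearMap.fst ℝ ℝ ℝ
      + ContinuousLinearMap.snd ℝ ℝ ℝ) - (cpar w / tpar w) • dT) w := by
  have h1 := (hasFDerivAt_fst (𝕜 := ℝ) (p := w)).add (hasFDerivAt_snd (𝕜 := ℝ) (p := w))
  have h2 := (hasDerivAt_inv hw).comp_hasFDerivAt w (hasFDerivAt_tpar w)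
  have h3 := (h1.mul h2).const_mul (1 / 2 : ℝ)
  refine (h3.congr_of_eventuallyEq (Filter.Eventually.of_forall fun v => ?_)).congr_fderiv ?_
  · simp only [cpar, Pi.add_apply, Pi.mul_apply, Function.comp]
    rw [div_eq_mul_inv, mul_inv]
    ring
  · ext <;> simp [cpar] <;> field_simp <;> ring

theorem branch_facts {t : ℝ} (ht : 1 < t) (w : ℝ × ℝ) (hw : tpar w = t) (x0 : ℝ × ℝ → ℝ)
    (D : ℝ × ℝ →L[ℝ] ℝ) (hD : HasFDerivAt x0 D w) (x σ : ℕ → ℝ) (h0 : x0 w = x 0)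
    (hx : ∀ k, x (k + 1) = t * x k + σ k * (t - 1)) (k : ℕ) :
    branchIter x0 σ k w = x k ∧ HasFDerivAt (branchIter x0 σ k)
      (t ^ k • D + (wsum t x k + (x k - t ^ k * x 0) / (t - 1)) • dT) w := by
  have t1 : t - 1 ≠ 0 := by linarith
  induction k with
  | zero => simpa [branchIter, wsum] using ⟨h0, hD⟩
  | succ k ih =>
    obtain ⟨e, hd⟩ := ih
    refine ⟨by simp only [branchIter]; rw [e, hw, hx], ?_⟩
    have hT := hasFDerivAt_tpar w
    have := (hT.mul hd).add ((hT.sub_const 1).const_mul (σ k))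
    refine this.congr_fderiv ?_
    rw [e, hw, hx]
    ext <;> simp [wsum] <;> field_simp <;> ring

theorem wsum_sub {t c : ℝ} (ht : 1 < t) (x : ℕ → ℝ) (n : ℕ) :
    wsum t (fun k => x k - c) n = wsum t x n - c * (t ^ n - 1) / (t - 1) := by
  have t1 : t - 1 ≠ 0 := by linarith
  induction n with
  | zero => simp [wsum]
  | succ n ih =>
    simp only [wsum, ih]
    field_simp
    ring

theorem lorenz_step (t c a : ℝ) (k : ℕ) : (lorenz t c)^[k + 1] a
    = t * (lorenz t c)^[k] a + lorenzSign t c a k * (t - 1) := by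
  rw [Function.iterate_succ_apply', lorenzSign]
  by_cases h : (lorenz t c)^[k] a < c
  · rw [if_pos h, lorenz, if_pos h]; ring
  · rw [if_neg h, lorenz, if_neg h]; ring

theorem lorenz_sign (t c a : ℝ) (k : ℕ) (h : (lorenz t c)^[k] a ≠ c) :
    ((lorenz t c)^[k] a < c ∧ lorenzSign t c a k = 1) ∨
      (c < (lorenz t c)^[k] a ∧ lorenzSign t c a k = -1) := by
  rcases lt_or_gt_of_ne h with h | h
  · exact Or.inl ⟨h, by simp [lorenzSign, h]⟩
  · exact Or.inr ⟨h, by simp [lorenzSign, not_lt.mpr (le_of_lt h)]⟩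

theorem stmt8 (t c : ℝ) (ht1 : 1 < t) (ht2 : t ≤ 2) (hc : -1 < c) (hc' : c < 1)
    (q₁ q₂ : ℕ) (hq₁ : 1 ≤ q₁) (hq₂ : 1 ≤ q₂)
    (a₁ b₁ : ℝ) (ha₁ : a₁ = t * c + (t - 1)) (hb₁ : b₁ = t * c - (t - 1))
    (hA : ∀ j, j < q₁ - 1 → (lorenz t c)^[j] a₁ ∈ Set.Icc (-1 : ℝ) 1 \ {c})
    (hAend : (lorenz t c)^[q₁ - 1] a₁ = c)
    (hB : ∀ j, j < q₂ - 1 → (lorenz t c)^[j] b₁ ∈ Set.Icc (-1 : ℝ) 1 \ {c})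
    (hBend : (lorenz t c)^[q₂ - 1] b₁ = c) :
    0 < (fderiv ℝ (fun w : ℝ × ℝ =>
        (branchIter Prod.fst (lorenzSign t c a₁) (q₁ - 1) w - cpar w,
         branchIter Prod.snd (lorenzSign t c b₁) (q₂ - 1) w - cpar w)) (a₁, b₁)).det := by
  obtain ⟨n, rfl⟩ : ∃ n, q₁ = n + 1 := ⟨q₁ - 1, by omega⟩
  obtain ⟨m, rfl⟩ : ∃ m, q₂ = m + 1 := ⟨q₂ - 1, by omega⟩
  simp only [Nat.add_sub_cancel] at *
  have t0 : 0 < t := by linarith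
  have t1 : 0 < t - 1 := by linarith
  have hw : tpar (a₁, b₁) = t := by simp only [tpar]; rw [ha₁, hb₁]; ring
  have hcw : cpar (a₁, b₁) = c := by
    simp only [cpar]; rw [hw, ha₁, hb₁]; field_simp; ring
  have hca : c < a₁ := by rw [ha₁]; nlinarith
  have ha1 : a₁ ≤ 1 := by
    rcases Nat.eq_zero_or_pos n with h | h
    · subst h; simp at hAend; linarith
    · exact (hA 0 h).1.2
  have hxs := lorenz_step t c a₁
  have hys := lorenz_step t c b₁
  have main := main_pos ht1 hc (fun k => (lorenz t c)^[k] a₁) (lorenzSign t c a₁)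
    (fun k => (lorenz t c)^[k] b₁) (lorenzSign t c b₁) n m ha₁ hb₁ ha1 hAend hBend hxs hys
    (fun k hk => lorenz_sign t c a₁ k (hA k hk).2) (fun k hk => lorenz_sign t c b₁ k (hB k hk).2)
  obtain ⟨-, dx⟩ := branch_facts ht1 (a₁, b₁) hw Prod.fst _ hasFDerivAt_fst
    (fun k => (lorenz t c)^[k] a₁) (lorenzSign t c a₁) rfl hxs n
  obtain ⟨-, dy⟩ := branch_facts ht1 (a₁, b₁) hw Prod.snd _ hasFDerivAt_snd
    (fun k => (lorenz t c)^[k] b₁) (lorenzSign t c b₁) rfl hys m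
  have dc := hasFDerivAt_cpar (a₁, b₁) (by rw [hw]; exact t0.ne')
  rw [hw, hcw] at dc
  have dR := (dx.sub dc).prodMk (dy.sub dc)
  have e : fderiv ℝ (fun w : ℝ × ℝ =>
        (branchIter Prod.fst (lorenzSign t c a₁) n w - cpar w,
         branchIter Prod.snd (lorenzSign t c b₁) m w - cpar w)) (a₁, b₁) = _ := dR.fderiv
  rw [e, det_prod]
  simp only [wsum_sub ht1] at main
  simp only [wsum] at main
  simp only [hAend, hBend] at main ⊢
  generalize wsum t (fun k => (lorenz t c)^[k] a₁) n = U at *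
  generalize wsum t (fun k => (lorenz t c)^[k] b₁) m = V at *
  have A0 : 0 < t ^ (n + 1) - 1 := by linarith [one_lt_pow₀ ht1 (Nat.add_one_ne_zero n)]
  have B0 : 0 < t ^ (m + 1) - 1 := by linarith [one_lt_pow₀ ht1 (Nat.add_one_ne_zero m)]
  rw [div_lt_div_iff₀ B0 A0] at main
  simp [dT]
  rw [pow_succ] at *
  rw [pow_succ] at *
  generalize t ^ n = P at *
  generalize t ^ m = Q at *
  subst ha₁ hb₁
  rw [← sub_pos] at main ⊢
  refine lt_of_lt_of_eq (mul_pos main (show 0 < 1 / (2 * t ^ 2) by positivity)) ?_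
  field_simp
  ring
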